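/- Let K_c > 0, t₀ > 0, and let a₀, a₁ : [0,t₀] → ℝ be continuous functions, and let M̃ > 0 satisfy |a₁(t)/K_c| + √((a₁(t)/K_c)² + 2|a₀(t)/K_c|) ≤ M̃ for all t ∈ [0,t₀]. Then there is no differentiable function y : [0,t₀] → ℝ satisfying y′(t) = −K_c y(t)² − a₁(t) y(t) + a₀(t) for all t ∈ [0,t₀] together with y(0) < −max{2/(K_c t₀), M̃}; i.e., any solution of this Riccati equation with such initial data blows up (tends to −∞) strictly before time t₀. -/

import Mathlib

open Real Set

/-- Beyond the larger root of `z² / 2 - |p| z - |q|`, half of the square dominates the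
lower order terms of the Riccati nonlinearity. -/
theorem half_sq_le_of_le_neg_root {p q M x : ℝ}
    (hM : |p| + √(p ^ 2 + 2 * |q|) ≤ M) (hx : x ≤ -M) :
    x ^ 2 / 2 ≤ x ^ 2 + p * x - q := by
  have hs : √(p ^ 2 + 2 * |q|) ≤ -x - |p| := by linarith
  have hsq := (Real.sqrt_le_left ((Real.sqrt_nonneg _).trans hs)).1 hs
  have hx0 : x ≤ 0 := by linarith [abs_nonneg p, Real.sqrt_nonneg (p ^ 2 + 2 * |q|)]
  nlinarith [sq_abs p, le_abs_self q, mul_nonneg (sub_nonneg.2 (le_abs_self p)) (neg_nonneg.2 hx0)]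

theorem riccati_deriv_le {K a b M x : ℝ} (hK : 0 < K)
    (hM : |a / K| + √((a / K) ^ 2 + 2 * |b / K|) ≤ M) (hx : x ≤ -M) :
    -K * x ^ 2 - a * x + b ≤ -(K / 2 * x ^ 2) := by
  have h := mul_le_mul_of_nonneg_left (half_sq_le_of_le_neg_root hM hx) hK.le
  have e : K * (x ^ 2 + a / K * x - b / K) = K * x ^ 2 + a * x - b := by
    field_simp
  linarith

/-- A negative function with `y' ≤ -c y²` on `[0, T]` satisfies `-1 < c T y(0)`. -/
theorem neg_one_lt_of_deriv_le_neg_sq {c T : ℝ} (hT : 0 ≤ T) {y y' : ℝ → ℝ}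
    (hy : ∀ t ∈ Icc 0 T, HasDerivAt y (y' t) t) (hneg : ∀ t ∈ Icc 0 T, y t < 0)
    (hle : ∀ t ∈ Icc 0 T, y' t ≤ -(c * y t ^ 2)) : -1 < c * T * y 0 := by
  have hd : ∀ t ∈ Icc 0 T, HasDerivAt (fun s => c * s - (y s)⁻¹)
      (c * 1 - -y' t / y t ^ 2) t := fun t ht =>
    ((hasDerivAt_id t).const_mul c).sub ((hy t ht).inv (hneg t ht).ne)
  have hanti : AntitoneOn (fun s => c * s - (y s)⁻¹) (Icc 0 T) := by
    refine antitoneOn_of_hasDerivWithinAt_nonpos (convex_Icc 0 T)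
      (fun t ht => (hd t ht).continuousAt.continuousWithinAt)
      (fun t ht => (hd t (interior_subset ht)).hasDerivWithinAt) fun t ht => ?_
    have ht' := interior_subset ht
    have hpos : 0 < y t ^ 2 := sq_pos_of_neg (hneg t ht')
    have : c ≤ -y' t / y t ^ 2 := by
      rw [le_div_iff₀ hpos]
      linarith [hle t ht']
    linarith
  have h0 : (0 : ℝ) ∈ Icc 0 T := left_mem_Icc.2 hT
  have hT' : T ∈ Icc 0 T := right_mem_Icc.2 hT
  have h := hanti h0 hT' hT
  have hlt : c * T < -(y 0)⁻¹ := by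
    have := inv_lt_zero.2 (hneg T hT')
    simp only [mul_zero, zero_sub] at h
    linarith
  have := mul_lt_mul_of_neg_right hlt (hneg 0 h0)
  rwa [neg_mul, inv_mul_cancel₀ (hneg 0 h0).ne] at this

theorem stmt18 (Kc t₀ Mt : ℝ) (hKc : 0 < Kc) (ht₀ : 0 < t₀) (hMt : 0 < Mt)
    (a₀ a₁ : ℝ → ℝ)
    (ha₀c : ContinuousOn a₀ (Icc 0 t₀)) (ha₁c : ContinuousOn a₁ (Icc 0 t₀))
    (hbound : ∀ t ∈ Icc (0 : ℝ) t₀,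
      |a₁ t / Kc| + Real.sqrt ((a₁ t / Kc) ^ 2 + 2 * |a₀ t / Kc|) ≤ Mt)
    (y : ℝ → ℝ)
    (hy : ∀ t ∈ Icc (0 : ℝ) t₀, HasDerivAt y (-Kc * y t ^ 2 - a₁ t * y t + a₀ t) t)
    (h0 : y 0 < -max (2 / (Kc * t₀)) Mt) : False := by
  have hM : y 0 < -Mt := h0.trans_le (neg_le_neg (le_max_right _ _))
  have hK : y 0 < -(2 / (Kc * t₀)) := h0.trans_le (neg_le_neg (le_max_left _ _))
  have hle : ∀ t ∈ Icc 0 t₀, y t ≤ y 0 := by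
    refine image_le_of_deriv_right_lt_deriv_boundary
      (fun t ht => (hy t ht).continuousAt.continuousWithinAt)
      (fun t ht => (hy t (Ico_subset_Icc_self ht)).hasDerivWithinAt) le_rfl
      (fun t => hasDerivAt_const t (y 0)) fun t ht hyt => ?_
    have hneg : y t < 0 := by linarith
    have := riccati_deriv_le hKc (hbound t (Ico_subset_Icc_self ht)) (hyt.trans_le hM.le)
    have : 0 < Kc / 2 * y t ^ 2 := mul_pos (half_pos hKc) (sq_pos_of_neg hneg)
    linarith
  have h := neg_one_lt_of_deriv_le_neg_sq (c := Kc / 2) ht₀.le hy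
    (fun t ht => by linarith [hle t ht])
    (fun t ht => riccati_deriv_le hKc (hbound t ht) ((hle t ht).trans hM.le))
  have hpos : 0 < Kc * t₀ := mul_pos hKc ht₀
  have := mul_lt_mul_of_pos_left hK hpos
  rw [mul_neg, mul_div_cancel₀ _ hpos.ne'] at this
  linarith
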